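/- Consider an admissible length-k trajectory model (G, A, D, M_0, z_0,…,z_{k−1}, f_0,…,f_{k−1}, M_1,…,M_k) with k ≥ 1. Then the mutual information between the data and the trajectory equals the sum of the conditional entropies of the model updates: I(D; (M_0, M_1, …, M_k)) = Σ_{j=0}^{k−1} H( f_j(M_j, D) | M_j ). -/

import Mathlib

open MeasureTheory ProbabilityTheory

/-- Shannon entropy of a finite-valued random variable `X` under measure `μ`:
`H(X) = ∑ x, −P(X = x) · log P(X = x)`. -/
noncomputable def entropy {Ω S : Type*} [MeasurableSpace Ω] [Fintype S]
    (μ : Measure Ω) (X : Ω → S) : ℝ :=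
  ∑ x : S, Real.negMulLog (μ (X ⁻¹' {x})).toReal

/-- Conditional entropy `H(X | Y) = ∑ y, P(Y = y) · H(X | Y = y)`, where the inner
entropy is taken under the conditional probability measure given `{Y = y}`. -/
noncomputable def condEntropy {Ω S T : Type*} [MeasurableSpace Ω] [Fintype S] [Fintype T]
    (μ : Measure Ω) (X : Ω → S) (Y : Ω → T) : ℝ :=
  ∑ y : T, (μ (Y ⁻¹' {y})).toReal * entropy (μ[|Y ⁻¹' {y}]) X

/-- Mutual information `I(X ; Y) = H(X) − H(X | Y)`. -/
noncomputable def mutualInfo {Ω S T : Type*} [MeasurableSpace Ω] [Fintype S] [Fintype T]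
    (μ : Measure Ω) (X : Ω → S) (Y : Ω → T) : ℝ :=
  entropy μ X - condEntropy μ X Y

/-- `X` is conditionally independent of `W` given `Y`: for every value `y` of `Y` with
positive probability, the conditional joint pmf of `(X, W)` given `{Y = y}` factorizes
into the product of the conditional marginals. -/
def CondIndepFun {Ω S U T : Type*} [MeasurableSpace Ω]
    (μ : Measure Ω) (X : Ω → S) (W : Ω → U) (Y : Ω → T) : Prop :=
  ∀ y : T, 0 < μ (Y ⁻¹' {y}) → ∀ (x : S) (w : U),
    (μ[|Y ⁻¹' {y}]) (X ⁻¹' {x} ∩ W ⁻¹' {w}) =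
      (μ[|Y ⁻¹' {y}]) (X ⁻¹' {x}) * (μ[|Y ⁻¹' {y}]) (W ⁻¹' {w})

/-- An admissible length-`k` trajectory model: data `D`, model states `M_0, …, M_k` in a
finite additive commutative group `G`, noises `Z_0, …, Z_{k−1}` and update functions
`f_0, …, f_{k−1}` such that
(0) `M_{j+1} = f_j (M_j, D) + Z_j` for `0 ≤ j ≤ k−1`;
(i) the family `{D, M_0, Z_0, …, Z_{k−1}}` is mutually independent (stated via the
    joint-pmf factorization, which characterizes mutual independence for finite-valued
    random variables);
(ii) for each `1 ≤ j ≤ k−1`, `M_{j+1}` is conditionally independent of `(M_0,…,M_{j−1})`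
    given `M_j`, and also given `(D, M_j)`;
(iii) for each `0 ≤ j ≤ k−1` and each `m` with `P(M_j = m) > 0`, the addition map is
    injective on the product of the support of `f_j(M_j, D)` jointly with `{M_j = m}`
    and the support of `Z_j`. -/
def Admissible {Ω G A : Type*} [MeasurableSpace Ω] [AddCommGroup G]
    (μ : MeasureTheory.Measure Ω) (k : ℕ) (D : Ω → A) (M : ℕ → Ω → G) (Z : ℕ → Ω → G)
    (f : ℕ → G × A → G) : Prop :=
  (∀ j < k, ∀ ω, M (j + 1) ω = f j (M j ω, D ω) + Z j ω) ∧
  (∀ (a : A) (m0 : G) (zs : Fin k → G),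
      μ (D ⁻¹' {a} ∩ M 0 ⁻¹' {m0} ∩ ⋂ j : Fin k, Z j.val ⁻¹' {zs j}) =
        μ (D ⁻¹' {a}) * μ (M 0 ⁻¹' {m0}) * ∏ j : Fin k, μ (Z j.val ⁻¹' {zs j})) ∧
  (∀ j, 1 ≤ j → j < k →
      CondIndepFun μ (M (j + 1)) (fun ω (i : Fin j) => M i.val ω) (M j) ∧
      CondIndepFun μ (M (j + 1)) (fun ω (i : Fin j) => M i.val ω)
        (fun ω => (D ω, M j ω))) ∧
  (∀ j < k, ∀ m : G, 0 < μ (M j ⁻¹' {m}) →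
      Set.InjOn (fun p : G × G => p.1 + p.2)
        ({x : G | 0 < μ ((fun ω => f j (M j ω, D ω)) ⁻¹' {x} ∩ M j ⁻¹' {m})} ×ˢ
          {zv : G | 0 < μ (Z j ⁻¹' {zv})}))

lemma entropy_comp_of_injOn {Ω S T : Type*} [MeasurableSpace Ω] [Fintype S] [Fintype T]
    [MeasurableSpace T] [MeasurableSingletonClass T] (μ : Measure Ω) [IsFiniteMeasure μ]
    {Y : Ω → T} (hY : Measurable Y) {g : T → S}
    (hg : Set.InjOn g {t | μ (Y ⁻¹' {t}) ≠ 0}) :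
    entropy μ (fun ω => g (Y ω)) = entropy μ Y := by
  classical
  unfold entropy
  rw [← Finset.sum_fiberwise Finset.univ g (fun t => Real.negMulLog (μ (Y ⁻¹' {t})).toReal)]
  refine Finset.sum_congr rfl fun s _ => ?_
  have hfib : μ ((fun ω => g (Y ω)) ⁻¹' {s}) =
      ∑ t ∈ Finset.univ.filter (fun t => g t = s), μ (Y ⁻¹' {t}) := by
    rw [sum_measure_preimage_singleton _ fun t _ => hY (measurableSet_singleton t)]
    congr 1
    ext ω
    simp
  rw [hfib]
  by_cases h : ∃ t, g t = s ∧ μ (Y ⁻¹' {t}) ≠ 0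
  · obtain ⟨t, hts, ht⟩ := h
    have hzero : ∀ t' ∈ Finset.univ.filter (fun t => g t = s), t' ≠ t → μ (Y ⁻¹' {t'}) = 0 := by
      intro t' ht' hne
      by_contra h0
      exact hne (hg h0 ht (by rw [hts]; simpa using ht'))
    rw [Finset.sum_eq_single t hzero (by simp [hts]),
      Finset.sum_eq_single t (fun t' ht' hne => by simp [hzero t' ht' hne]) (by simp [hts])]
  · push Not at h
    rw [Finset.sum_eq_zero fun t ht => h t (by simpa using ht), Finset.sum_eq_zero]
    · simp
    · intro t ht
      simp [h t (by simpa using ht)]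

lemma sum_toReal_measure_preimage_singleton {Ω S : Type*} [MeasurableSpace Ω] [Fintype S]
    [MeasurableSpace S] [MeasurableSingletonClass S] (μ : Measure Ω) [IsProbabilityMeasure μ]
    {X : Ω → S} (hX : Measurable X) : ∑ x, (μ (X ⁻¹' {x})).toReal = 1 := by
  rw [← ENNReal.toReal_sum (fun _ _ => measure_ne_top _ _),
    sum_measure_preimage_singleton _ fun x _ => hX (measurableSet_singleton x)]
  simp

lemma preimage_prodMk_singleton {Ω S T : Type*} (X : Ω → S) (Y : Ω → T) (x : S) (y : T) :
    (fun ω => (X ω, Y ω)) ⁻¹' {(x, y)} = X ⁻¹' {x} ∩ Y ⁻¹' {y} := by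
  ext ω
  simp

/-- The chain rule `H(X | Y) = H(X, Y) - H(Y)`. -/
lemma condEntropy_eq_entropy_prodMk_sub {Ω S T : Type*} [MeasurableSpace Ω]
    [Fintype S] [Fintype T] [MeasurableSpace S] [MeasurableSingletonClass S]
    [MeasurableSpace T] [MeasurableSingletonClass T] (μ : Measure Ω) [IsFiniteMeasure μ]
    {X : Ω → S} {Y : Ω → T} (hX : Measurable X) (hY : Measurable Y) :
    condEntropy μ X Y = entropy μ (fun ω => (X ω, Y ω)) - entropy μ Y := by
  unfold condEntropy entropy
  rw [Fintype.sum_prod_type_right, ← Finset.sum_sub_distrib]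
  refine Finset.sum_congr rfl fun y _ => ?_
  have hfac : ∀ x, (μ ((fun ω => (X ω, Y ω)) ⁻¹' {(x, y)})).toReal =
      ((μ[|Y ⁻¹' {y}]) (X ⁻¹' {x})).toReal * (μ (Y ⁻¹' {y})).toReal := by
    intro x
    rw [← ENNReal.toReal_mul, cond_mul_eq_inter (hY (measurableSet_singleton y)),
      preimage_prodMk_singleton, Set.inter_comm]
  simp_rw [hfac, Real.negMulLog_mul, Finset.sum_add_distrib, ← Finset.mul_sum, ← Finset.sum_mul]
  by_cases h0 : μ (Y ⁻¹' {y}) = 0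
  · simp [h0]
  · have := cond_isProbabilityMeasure h0
    rw [sum_toReal_measure_preimage_singleton _ hX]
    ring

lemma entropy_prodMk_of_indep {Ω S T : Type*} [MeasurableSpace Ω] [Fintype S] [Fintype T]
    [MeasurableSpace S] [MeasurableSingletonClass S]
    [MeasurableSpace T] [MeasurableSingletonClass T] (μ : Measure Ω) [IsProbabilityMeasure μ]
    {X : Ω → S} {Y : Ω → T} (hX : Measurable X) (hY : Measurable Y)
    (h : ∀ x y, μ (X ⁻¹' {x} ∩ Y ⁻¹' {y}) = μ (X ⁻¹' {x}) * μ (Y ⁻¹' {y})) :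
    entropy μ (fun ω => (X ω, Y ω)) = entropy μ X + entropy μ Y := by
  unfold entropy
  simp_rw [Fintype.sum_prod_type, preimage_prodMk_singleton, h, ENNReal.toReal_mul,
    Real.negMulLog_mul, Finset.sum_add_distrib, ← Finset.sum_mul, ← Finset.mul_sum,
    ← Finset.sum_mul, sum_toReal_measure_preimage_singleton _ hX,
    sum_toReal_measure_preimage_singleton _ hY, one_mul]

lemma CondIndepFun.entropy_add_entropy {Ω S U T : Type*} [MeasurableSpace Ω]
    [Fintype S] [Fintype U] [Fintype T] [MeasurableSpace S] [MeasurableSingletonClass S]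
    [MeasurableSpace U] [MeasurableSingletonClass U]
    [MeasurableSpace T] [MeasurableSingletonClass T] (μ : Measure Ω) [IsFiniteMeasure μ]
    {X : Ω → S} {W : Ω → U} {Y : Ω → T} (hX : Measurable X) (hW : Measurable W)
    (hY : Measurable Y) (h : CondIndepFun μ X W Y) :
    entropy μ (fun ω => ((X ω, W ω), Y ω)) + entropy μ Y =
      entropy μ (fun ω => (X ω, Y ω)) + entropy μ (fun ω => (W ω, Y ω)) := by
  have hcond : condEntropy μ (fun ω => (X ω, W ω)) Y = condEntropy μ X Y + condEntropy μ W Y := by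
    unfold condEntropy
    rw [← Finset.sum_add_distrib]
    refine Finset.sum_congr rfl fun y _ => ?_
    by_cases h0 : μ (Y ⁻¹' {y}) = 0
    · simp [h0]
    · have := cond_isProbabilityMeasure h0
      rw [entropy_prodMk_of_indep _ hX hW (h y (pos_iff_ne_zero.mpr h0)), mul_add]
  rw [condEntropy_eq_entropy_prodMk_sub μ (hX.prodMk hW) hY,
    condEntropy_eq_entropy_prodMk_sub μ hX hY, condEntropy_eq_entropy_prodMk_sub μ hW hY] at hcond
  linarith

lemma mutualInfo_eq_entropy_add_sub {Ω S T : Type*} [MeasurableSpace Ω]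
    [Fintype S] [Fintype T] [MeasurableSpace S] [MeasurableSingletonClass S]
    [MeasurableSpace T] [MeasurableSingletonClass T] (μ : Measure Ω) [IsFiniteMeasure μ]
    {X : Ω → S} {Y : Ω → T} (hX : Measurable X) (hY : Measurable Y) :
    mutualInfo μ X Y = entropy μ X + entropy μ Y - entropy μ (fun ω => (X ω, Y ω)) := by
  rw [mutualInfo, condEntropy_eq_entropy_prodMk_sub μ hX hY]
  ring

lemma indepFun_of_measure_inter_preimage_singleton {Ω S T : Type*} [MeasurableSpace Ω]
    [Countable S] [Countable T] [MeasurableSpace S] [MeasurableSingletonClass S]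
    [MeasurableSpace T] [MeasurableSingletonClass T] {μ : Measure Ω} [IsFiniteMeasure μ]
    {X : Ω → S} {Y : Ω → T} (hX : Measurable X) (hY : Measurable Y)
    (h : ∀ x y, μ (X ⁻¹' {x} ∩ Y ⁻¹' {y}) = μ (X ⁻¹' {x}) * μ (Y ⁻¹' {y})) :
    IndepFun X Y μ := by
  rw [indepFun_iff_map_prod_eq_prod_map_map hX.aemeasurable hY.aemeasurable]
  refine Measure.ext_of_singleton fun ⟨x, y⟩ => ?_
  rw [← Set.singleton_prod_singleton, Measure.prod_prod,
    Measure.map_apply hX (measurableSet_singleton x),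
    Measure.map_apply hY (measurableSet_singleton y), Set.singleton_prod_singleton,
    Measure.map_apply (hX.prodMk hY) (measurableSet_singleton _), preimage_prodMk_singleton, h]

lemma measure_inter_sum_preimage_singleton {Ω S : Type*} [MeasurableSpace Ω] [Fintype S]
    [MeasurableSpace S] [MeasurableSingletonClass S] (μ : Measure Ω)
    {X : Ω → S} (hX : Measurable X) (s : Set Ω) : ∑ x, μ (s ∩ X ⁻¹' {x}) = μ s := by
  have := sum_measure_preimage_singleton (μ := μ.restrict s) Finset.univ
    fun x _ => hX (measurableSet_singleton x)
  simpa [Measure.restrict_apply (hX (measurableSet_singleton _)), Set.inter_comm] using this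

/-- Marginalising the last coordinates out of a factorised joint law. -/
lemma measure_inter_iInter_preimage_singleton_of_le {Ω G : Type*} [MeasurableSpace Ω]
    [Fintype G] [MeasurableSpace G] [MeasurableSingletonClass G] (μ : Measure Ω)
    [IsProbabilityMeasure μ] {Z : ℕ → Ω → G} (hZ : ∀ j, Measurable (Z j)) (s : Set Ω)
    {c : ENNReal} {n k : ℕ} (hnk : n ≤ k)
    (h : ∀ zs : Fin k → G, μ (s ∩ ⋂ j : Fin k, Z j.val ⁻¹' {zs j}) =
      c * ∏ j : Fin k, μ (Z j.val ⁻¹' {zs j})) (zs : Fin n → G) :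
    μ (s ∩ ⋂ j : Fin n, Z j.val ⁻¹' {zs j}) = c * ∏ j : Fin n, μ (Z j.val ⁻¹' {zs j}) := by
  induction k, hnk using Nat.le_induction with
  | base => exact h zs
  | succ k _ ih =>
    refine ih fun ws => ?_
    have hone : ∑ z, μ (Z k ⁻¹' {z}) = 1 := by
      simpa using measure_inter_sum_preimage_singleton μ (hZ k) Set.univ
    rw [← measure_inter_sum_preimage_singleton μ (hZ k), ← mul_one (c * _), ← hone,
      Finset.mul_sum]
    refine Finset.sum_congr rfl fun z _ => ?_
    have hz := h (Fin.snoc ws z)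
    rw [Fin.prod_univ_castSucc] at hz
    simp only [Fin.snoc_castSucc, Fin.snoc_last, Fin.val_castSucc, Fin.val_last] at hz
    rw [mul_assoc, ← hz]
    congr 1
    ext ω
    simp [Fin.forall_fin_succ', and_assoc]

section Admissible

variable {Ω : Type*} [MeasurableSpace Ω] {μ : Measure Ω} {G : Type*} [AddCommGroup G] {A : Type*}
  {k : ℕ} {D : Ω → A} {M Z : ℕ → Ω → G} {f : ℕ → G × A → G}

lemma Admissible.trajectory_eq_of_noise_eq (hAdm : Admissible μ k D M Z f) {n : ℕ} (hn : n ≤ k)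
    {ω ω' : Ω} (hD : D ω = D ω') (hM : M 0 ω = M 0 ω') (hZ : ∀ i < n, Z i ω = Z i ω') :
    ∀ i ≤ n, M i ω = M i ω' := by
  intro i hi
  induction i with
  | zero => exact hM
  | succ i ih =>
    rw [hAdm.1 i (by omega), hAdm.1 i (by omega), ih (by omega), hD, hZ i (by omega)]

variable [IsProbabilityMeasure μ] [Fintype G] [MeasurableSpace G] [DiscreteMeasurableSpace G]

lemma Admissible.measure_inter_data_init_noise (hAdm : Admissible μ k D M Z f)
    (hZ : ∀ j, Measurable (Z j)) {n : ℕ} (hn : n ≤ k) (a : A) (m : G) (zs : Fin n → G) :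
    μ (D ⁻¹' {a} ∩ M 0 ⁻¹' {m} ∩ ⋂ j : Fin n, Z j.val ⁻¹' {zs j}) =
      μ (D ⁻¹' {a}) * μ (M 0 ⁻¹' {m}) * ∏ j : Fin n, μ (Z j.val ⁻¹' {zs j}) :=
  measure_inter_iInter_preimage_singleton_of_le μ hZ _ hn (hAdm.2.1 a m) zs

lemma Admissible.measure_inter_data_init (hAdm : Admissible μ k D M Z f)
    (hZ : ∀ j, Measurable (Z j)) (a : A) (m : G) :
    μ (D ⁻¹' {a} ∩ M 0 ⁻¹' {m}) = μ (D ⁻¹' {a}) * μ (M 0 ⁻¹' {m}) := by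
  simpa using hAdm.measure_inter_data_init_noise hZ (Nat.zero_le k) a m Fin.elim0

lemma Admissible.entropy_trajectory_succ (hAdm : Admissible μ k D M Z f)
    (hM : ∀ j, Measurable (M j)) {n : ℕ} (hn : n < k) :
    entropy μ (fun ω (i : Fin (n + 1 + 1)) => M i.val ω) + entropy μ (M n) =
      entropy μ (fun ω => (M (n + 1) ω, M n ω)) +
        entropy μ (fun ω (i : Fin (n + 1)) => M i.val ω) := by
  have hW : Measurable fun ω (i : Fin n) => M i.val ω :=
    measurable_pi_lambda _ fun i => hM i.val
  have hci : CondIndepFun μ (M (n + 1)) (fun ω (i : Fin n) => M i.val ω) (M n) := by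
    rcases Nat.eq_zero_or_pos n with rfl | hpos
    · intro y hy x w
      have := cond_isProbabilityMeasure hy.ne'
      have huniv : (fun ω (i : Fin 0) => M i.val ω) ⁻¹' {w} = Set.univ :=
        Set.eq_univ_of_forall fun ω => Subsingleton.elim _ _
      rw [huniv, Set.inter_univ, measure_univ, mul_one]
    · exact (hAdm.2.2.1 n hpos hn).1
  have hsnoc : Function.Injective fun p : (Fin n → G) × G =>
      (Fin.snoc p.1 p.2 : Fin (n + 1) → G) := by
    rintro ⟨t, x⟩ ⟨t', x'⟩ h
    simpa [Fin.snoc_inj] using h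
  have hsnoc₂ : Function.Injective fun p : (G × (Fin n → G)) × G =>
      (Fin.snoc (Fin.snoc p.1.2 p.2 : Fin (n + 1) → G) p.1.1 : Fin (n + 1 + 1) → G) := by
    rintro ⟨⟨y, t⟩, x⟩ ⟨⟨y', t'⟩, x'⟩ h
    simp only [Fin.snoc_inj] at h
    simp [h]
  have h := hci.entropy_add_entropy μ (hM (n + 1)) hW (hM n)
  rw [← entropy_comp_of_injOn μ (hW.prodMk (hM n)) hsnoc.injOn,
    ← entropy_comp_of_injOn μ (((hM (n + 1)).prodMk hW).prodMk (hM n)) hsnoc₂.injOn] at h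
  convert h using 3 <;> funext ω i
  · refine Fin.lastCases ?_ (fun i => ?_) i
    · simp
    · refine Fin.lastCases ?_ (fun i => ?_) i <;> simp
  · refine Fin.lastCases ?_ (fun i => ?_) i <;> simp

variable [Fintype A] [MeasurableSpace A] [DiscreteMeasurableSpace A]

/-- The noise at step `n` is independent of the data and of the trajectory up to step `n`. -/
lemma Admissible.indepFun_data_trajectory_noise (hAdm : Admissible μ k D M Z f)
    (hD : Measurable D) (hM : ∀ j, Measurable (M j)) (hZ : ∀ j, Measurable (Z j))
    {n : ℕ} (hn : n < k) :
    IndepFun (fun ω => (D ω, fun i : Fin (n + 1) => M i.val ω)) (Z n) μ := by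
  let V : Ω → (A × G) × (Fin n → G) := fun ω => ((D ω, M 0 ω), fun i => Z i.val ω)
  have hV : Measurable V :=
    (hD.prodMk (hM 0)).prodMk (measurable_pi_lambda _ fun i => hZ i.val)
  have hVZ : IndepFun V (Z n) μ := by
    refine indepFun_of_measure_inter_preimage_singleton hV (hZ n) ?_
    rintro ⟨⟨a, m⟩, zs⟩ z
    have hpre : V ⁻¹' {((a, m), zs)} =
        D ⁻¹' {a} ∩ M 0 ⁻¹' {m} ∩ ⋂ j : Fin n, Z j.val ⁻¹' {zs j} := by
      ext ω
      simp [V, funext_iff]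
    have hsucc := hAdm.measure_inter_data_init_noise hZ hn a m (Fin.snoc zs z)
    rw [Fin.prod_univ_castSucc] at hsucc
    simp only [Fin.snoc_castSucc, Fin.snoc_last, Fin.val_castSucc, Fin.val_last] at hsucc
    rw [hpre, hAdm.measure_inter_data_init_noise hZ hn.le, mul_assoc, ← hsucc]
    congr 1
    ext ω
    simp [Fin.forall_fin_succ', and_assoc]
  obtain ⟨ω₀⟩ := nonempty_of_isProbabilityMeasure μ
  have : Nonempty (A × (Fin (n + 1) → G)) := ⟨(D ω₀, 0)⟩
  have hfac : Function.FactorsThrough (fun ω => (D ω, fun i : Fin (n + 1) => M i.val ω)) V := by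
    intro ω ω' h
    simp only [V, Prod.mk.injEq, funext_iff] at h
    refine Prod.ext h.1.1 (funext fun i => ?_)
    exact hAdm.trajectory_eq_of_noise_eq hn.le h.1.1 h.1.2
      (fun i hi => h.2 ⟨i, hi⟩) i.val (Nat.lt_succ_iff.mp i.isLt)
  obtain ⟨g, hg⟩ := (Function.factorsThrough_iff _).mp hfac
  rw [hg]
  exact hVZ.comp (Measurable.of_discrete (f := g)) measurable_id

lemma Admissible.entropy_data_trajectory_succ (hAdm : Admissible μ k D M Z f)
    (hD : Measurable D) (hM : ∀ j, Measurable (M j)) (hZ : ∀ j, Measurable (Z j))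
    {n : ℕ} (hn : n < k) :
    entropy μ (fun ω => (D ω, fun i : Fin (n + 1 + 1) => M i.val ω)) =
      entropy μ (fun ω => (D ω, fun i : Fin (n + 1) => M i.val ω)) + entropy μ (Z n) := by
  have hT : Measurable fun ω => (D ω, fun i : Fin (n + 1) => M i.val ω) :=
    hD.prodMk (measurable_pi_lambda _ fun i => hM i.val)
  rw [← entropy_prodMk_of_indep μ hT (hZ n) fun x y =>
    (hAdm.indepFun_data_trajectory_noise hD hM hZ hn).measure_inter_preimage_eq_mul _ _
      (measurableSet_singleton x) (measurableSet_singleton y)]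
  let g : (A × (Fin (n + 1) → G)) × G → A × (Fin (n + 1 + 1) → G) := fun p =>
    (p.1.1, Fin.snoc p.1.2 (f n (p.1.2 (Fin.last n), p.1.1) + p.2))
  have hg : Function.Injective g := by
    rintro ⟨⟨a, t⟩, z⟩ ⟨⟨a', t'⟩, z'⟩ h
    simp only [g, Prod.mk.injEq, Fin.snoc_inj] at h
    obtain ⟨rfl, rfl, h⟩ := h
    simpa using h
  rw [← entropy_comp_of_injOn μ (hT.prodMk (hZ n)) hg.injOn]
  congr 1
  funext ω
  refine Prod.ext rfl (funext fun i => ?_)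
  refine Fin.lastCases ?_ (fun i => ?_) i
  · simp [g, hAdm.1 n hn]
  · simp [g]

lemma Admissible.entropy_succ_prodMk (hAdm : Admissible μ k D M Z f)
    (hD : Measurable D) (hM : ∀ j, Measurable (M j)) (hZ : ∀ j, Measurable (Z j))
    {n : ℕ} (hn : n < k) :
    entropy μ (fun ω => (M (n + 1) ω, M n ω)) =
      entropy μ (fun ω => (f n (M n ω, D ω), M n ω)) + entropy μ (Z n) := by
  have hF : Measurable fun ω => (f n (M n ω, D ω), M n ω) :=
    ((Measurable.of_discrete (f := f n)).comp ((hM n).prodMk hD)).prodMk (hM n)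
  have hind : IndepFun (fun ω => (f n (M n ω, D ω), M n ω)) (Z n) μ :=
    (hAdm.indepFun_data_trajectory_noise hD hM hZ hn).comp
      (Measurable.of_discrete (f := fun p : A × (Fin (n + 1) → G) =>
        (f n (p.2 (Fin.last n), p.1), p.2 (Fin.last n)))) measurable_id
  rw [← entropy_prodMk_of_indep μ hF (hZ n) fun x y =>
    hind.measure_inter_preimage_eq_mul _ _ (measurableSet_singleton x) (measurableSet_singleton y)]
  let g : (G × G) × G → G × G := fun p => (p.1.1 + p.2, p.1.2)
  rw [← entropy_comp_of_injOn μ (hF.prodMk (hZ n)) (g := g)]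
  · simp only [g, hAdm.1 n hn]
  rintro ⟨⟨x, m⟩, z⟩ hp ⟨⟨x', m'⟩, z'⟩ hp' h
  simp only [g, Prod.mk.injEq] at h
  obtain ⟨h, rfl⟩ := h
  simp only [Set.mem_ofPred_eq, preimage_prodMk_singleton] at hp hp'
  have hinj := hAdm.2.2.2 n hn m
    (measure_pos_of_superset (Set.inter_subset_left.trans Set.inter_subset_right) hp)
  have := @hinj (x, z)
    ⟨measure_pos_of_superset Set.inter_subset_left hp,
      measure_pos_of_superset Set.inter_subset_right hp⟩ (x', z')
    ⟨measure_pos_of_superset Set.inter_subset_left hp',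
      measure_pos_of_superset Set.inter_subset_right hp'⟩ h
  simp only [Prod.mk.injEq] at this
  simp [this]

end Admissible

/-- For an admissible length-`k` trajectory model (`k ≥ 1`), the mutual information
between the data and the trajectory is the sum of conditional entropies of the model
updates: `I(D; (M_0, …, M_k)) = ∑_{j=0}^{k−1} H(f_j(M_j, D) | M_j)`. -/
theorem mutualInfo_data_trajectory_eq_sum_condEntropy_updates
    {Ω : Type*} [MeasurableSpace Ω] (μ : Measure Ω) [IsProbabilityMeasure μ]
    {G : Type*} [Fintype G] [AddCommGroup G]
    [MeasurableSpace G] [DiscreteMeasurableSpace G]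
    {A : Type*} [Fintype A] [MeasurableSpace A] [DiscreteMeasurableSpace A]
    {k : ℕ} (hk : 1 ≤ k)
    (D : Ω → A) (M Z : ℕ → Ω → G) (f : ℕ → G × A → G)
    (hD : Measurable D) (hM : ∀ j, Measurable (M j)) (hZ : ∀ j, Measurable (Z j))
    (hAdm : Admissible μ k D M Z f) :
    mutualInfo μ D (fun ω (j : Fin (k + 1)) => M j.val ω) =
      ∑ j : Fin k, condEntropy μ (fun ω => f j.val (M j.val ω, D ω)) (M j.val) := by
  have hT (n : ℕ) : Measurable fun ω (i : Fin n) => M i.val ω :=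
    measurable_pi_lambda _ fun i => hM i.val
  suffices h : ∀ n ≤ k, mutualInfo μ D (fun ω (j : Fin (n + 1)) => M j.val ω) =
      ∑ j : Fin n, condEntropy μ (fun ω => f j.val (M j.val ω, D ω)) (M j.val) from h k le_rfl
  intro n hn
  induction n with
  | zero =>
    rw [mutualInfo_eq_entropy_add_sub μ hD (hT _), entropy_prodMk_of_indep μ hD (hT _)]
    · simp
    intro a t
    have hpre : (fun ω (i : Fin (0 + 1)) => M i.val ω) ⁻¹' {t} = M 0 ⁻¹' {t 0} := by
      ext ω
      simp [funext_iff]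
    rw [hpre, hAdm.measure_inter_data_init hZ]
  | succ n ih =>
    have hF : Measurable fun ω => f n (M n ω, D ω) :=
      (Measurable.of_discrete (f := f n)).comp ((hM n).prodMk hD)
    have ih := ih (by omega)
    rw [mutualInfo_eq_entropy_add_sub μ hD (hT _)] at ih
    have htraj := hAdm.entropy_trajectory_succ hM hn
    have hstep := hAdm.entropy_succ_prodMk hD hM hZ hn
    rw [mutualInfo_eq_entropy_add_sub μ hD (hT _), Fin.sum_univ_castSucc,
      hAdm.entropy_data_trajectory_succ hD hM hZ hn]
    simp only [Fin.val_castSucc, Fin.val_last]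
    rw [← ih, condEntropy_eq_entropy_prodMk_sub μ hF (hM n)]
    linarith
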